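/- arXiv:hep-th/0611012 — 2 statements merged into one kernel-verified Lean document; each statement's English description precedes it below -/
import Mathlib

section
/- Fused N-particle identity for SU(N): on (ℂ^N)^{⊗N} define, for 1 ≤ i < j ≤ N, the operator T_{ij} := id − P_{ij} if j = i+1 and T_{ij} := ((j−i)·id − P_{ij})/(j−i−1) if j > i+1 (T_{ij} equals S̃ acting on factors i,j evaluated at θ = (j−i)·iη, with the first-order pole at iη removed for adjacent pairs). Then the lexicographically ordered product (T_{12}∘T_{13}∘⋯∘T_{1N}) ∘ (T_{23}∘⋯∘T_{2N}) ∘ ⋯ ∘ T_{N−1,N} equals (N−1)!·E, where E is the rank-one operator with matrix entries E^{(β1,…,βN)}_{(α1,…,αN)} = ε_{β1…βN}·ε_{α1…αN}, ε being the totally antisymmetric Levi-Civita symbol on N indices with ε_{1,2,…,N} = 1. -/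
open Matrix

noncomputable section

open Classical in
/-- The totally antisymmetric Levi-Civita symbol: the sign of `f` if `f` is a
permutation, and `0` otherwise (i.e. if two indices coincide). -/
def levi {n : ℕ} (f : Fin n → Fin n) : ℤ :=
  if h : Function.Bijective f then ((Equiv.Perm.sign (Equiv.ofBijective f h) : ℤˣ) : ℤ) else 0

/-- The permutation operator P_{ij} on (ℂ^N)^{⊗N}, exchanging tensor factors i and j. -/
def permIJ (N : ℕ) (i j : Fin N) : Matrix (Fin N → Fin N) (Fin N → Fin N) ℂ :=
  fun α β => if β = α ∘ (Equiv.swap i j) then 1 else 0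

/-- The fused operator T_{ij}: for adjacent pairs (j = i+1) it is id − P_{ij}
(the R-matrix at θ = iη with the simple pole removed), and for j > i+1 it is
((j−i)·id − P_{ij})/(j−i−1), i.e. S̃ evaluated at θ = (j−i)·iη. -/
def Tfused (N : ℕ) (i j : Fin N) : Matrix (Fin N → Fin N) (Fin N → Fin N) ℂ :=
  if (j : ℕ) = (i : ℕ) + 1 then (1 : Matrix (Fin N → Fin N) (Fin N → Fin N) ℂ) - permIJ N i j
  else (((j : ℕ) : ℂ) - ((i : ℕ) : ℂ) - 1)⁻¹ •
    ((((j : ℕ) : ℂ) - ((i : ℕ) : ℂ)) • (1 : Matrix (Fin N → Fin N) (Fin N → Fin N) ℂ) -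
      permIJ N i j)

/-- The list of pairs (i,j) with i < j in lexicographic order. -/
def pairList (N : ℕ) : List (Fin N × Fin N) :=
  (List.finRange N).flatMap fun i => ((List.finRange N).filter fun j => i < j).map fun j => (i, j)

/-- The rank-one operator E with entries E^{(β)}_{(α)} = ε_{β1…βN}·ε_{α1…αN}. -/
def Eop (N : ℕ) : Matrix (Fin N → Fin N) (Fin N → Fin N) ℂ :=
  fun β α => ((levi β : ℤ) : ℂ) * ((levi α : ℤ) : ℂ)

section FusedFactor

variable {R : Type*} [Ring R] [Algebra ℂ R]

/-- The scalar relating the fused factor at distance `d` to `1 - d⁻¹ • x`. -/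
def fusedScalar (d : ℕ) : ℂ := if d = 1 then 1 else d / (d - 1)

/-- The fused factor at distance `d`, as a function of the exchange operator `x`. -/
def fusedFactor (d : ℕ) (x : R) : R := fusedScalar d • (1 - (d : ℂ)⁻¹ • x)

/-- The accumulated scalar of a row of `n` fused factors. -/
def rowScalar (n : ℕ) : ℂ := if n = 0 then 1 else n

lemma rowScalar_succ (n : ℕ) : rowScalar (n + 1) = fusedScalar (n + 1) * rowScalar n := by
  rcases n with _ | n
  · simp [rowScalar, fusedScalar]
  · have h : (n : ℂ) + 1 ≠ 0 := by exact_mod_cast n.succ_ne_zero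
    simp [rowScalar, fusedScalar]
    field_simp

lemma fusedFactor_mul (d : ℕ) (x y : R) :
    fusedFactor d x * y = fusedScalar d • (y - (d : ℂ)⁻¹ • (x * y)) := by
  simp [fusedFactor, sub_mul]

lemma row_mul_of_antisymm (n : ℕ) (P : Fin n → R) (y : R) (h : ∀ j, P j * y = -y) :
    ((List.finRange n).map fun j : Fin n => fusedFactor (j + 1) (P j)).prod * y =
      (rowScalar n * (n + 1)) • y := by
  induction n with
  | zero => simp [rowScalar]
  | succ n ih =>
    have h0 : (n : ℂ) + 1 ≠ 0 := by exact_mod_cast n.succ_ne_zero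
    have hlast : fusedFactor (n + 1) (P (Fin.last n)) * y =
        (fusedScalar (n + 1) * (1 + ((n : ℂ) + 1)⁻¹)) • y := by
      rw [fusedFactor_mul, h]
      push_cast
      module
    have ih' := ih (fun j => P j.castSucc) (fun j => h _)
    simp only [List.finRange_succ_last, List.map_append, List.map_map, List.prod_append,
      List.map_cons, List.map_nil, List.prod_singleton, Function.comp_def, Fin.val_castSucc,
      Fin.val_last, mul_assoc, hlast, mul_smul_comm, ih', smul_smul, rowScalar_succ]
    congr 1
    push_cast
    field_simp

/-- Acting on an element antisymmetric in the remaining factors, a row of fused factors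
becomes a linear combination of the single exchange operators. -/
lemma row_mul (n : ℕ) (P : Fin n → R) (A : R)
    (h : ∀ i j, i ≠ j → P i * (P j * A) = -(P j * A)) :
    ((List.finRange n).map fun j : Fin n => fusedFactor (j + 1) (P j)).prod * A =
      rowScalar n • (A - ∑ j, P j * A) := by
  induction n with
  | zero => simp [rowScalar]
  | succ n ih =>
    have h0 : (n : ℂ) + 1 ≠ 0 := by exact_mod_cast n.succ_ne_zero
    have ih' := ih (fun j => P j.castSucc)
      (fun i j hij => h _ _ ((Fin.castSucc_injective n).ne hij))
    have hP := row_mul_of_antisymm n (fun j => P j.castSucc) (P (Fin.last n) * A)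
      (fun j => h _ _ (Fin.castSucc_lt_last j).ne)
    simp only [List.finRange_succ_last, List.map_append, List.map_map, List.prod_append,
      List.map_cons, List.map_nil, List.prod_singleton, Function.comp_def, Fin.val_castSucc,
      Fin.val_last, mul_assoc, fusedFactor_mul, mul_smul_comm, mul_sub, ih', hP, smul_smul,
      rowScalar_succ, Fin.sum_univ_castSucc]
    rw [show ((n + 1 : ℕ) : ℂ)⁻¹ * (rowScalar n * (n + 1)) = rowScalar n by
      push_cast; field_simp]
    module

/-- The embedding of permutations of `Fin n` as the permutations of `Fin (n + 1)` fixing `0`. -/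
def permFixZero (n : ℕ) : Equiv.Perm (Fin n) →* Equiv.Perm (Fin (n + 1)) where
  toFun σ := Equiv.Perm.decomposeFin.symm (0, σ)
  map_one' := by
    ext i
    refine Fin.cases ?_ (fun i => ?_) i <;> simp
  map_mul' σ τ := by
    ext i
    refine Fin.cases ?_ (fun i => ?_) i <;> simp

lemma permFixZero_zero {n : ℕ} (σ : Equiv.Perm (Fin n)) : permFixZero n σ 0 = 0 := by
  simp [permFixZero]

lemma permFixZero_succ {n : ℕ} (σ : Equiv.Perm (Fin n)) (i : Fin n) :
    permFixZero n σ i.succ = (σ i).succ := by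
  simp [permFixZero]

lemma sign_permFixZero {n : ℕ} (σ : Equiv.Perm (Fin n)) :
    Equiv.Perm.sign (permFixZero n σ) = Equiv.Perm.sign σ := by
  simp [permFixZero, Equiv.Perm.decomposeFin.symm_sign]

lemma permFixZero_swap {n : ℕ} (i j : Fin n) :
    permFixZero n (Equiv.swap i j) = Equiv.swap i.succ j.succ := by
  ext k
  refine Fin.cases ?_ (fun k => ?_) k
  · rw [permFixZero_zero, Equiv.swap_apply_of_ne_of_ne (Fin.succ_ne_zero i).symm
      (Fin.succ_ne_zero j).symm]
  · simp only [permFixZero_succ, Equiv.swap_apply_def, Fin.succ_inj]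
    split_ifs <;> rfl

lemma decomposeFin_symm_eq_swap_mul {n : ℕ} (p : Fin (n + 1)) (σ : Equiv.Perm (Fin n)) :
    Equiv.Perm.decomposeFin.symm (p, σ) = Equiv.swap 0 p * permFixZero n σ := by
  ext i
  refine Fin.cases ?_ (fun i => ?_) i <;> simp [permFixZero_zero, permFixZero_succ]

/-- The antisymmetrizer `∑ σ, sign σ • φ σ` of a representation `φ`. -/
def antisymmetrizer {n : ℕ} (φ : Equiv.Perm (Fin n) →* R) : R :=
  ∑ σ, ((Equiv.Perm.sign σ : ℤ) : ℂ) • φ σ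

lemma swap_mul_antisymmetrizer {n : ℕ} (φ : Equiv.Perm (Fin n) →* R) {i j : Fin n}
    (h : i ≠ j) : φ (Equiv.swap i j) * antisymmetrizer φ = -antisymmetrizer φ := by
  simp only [antisymmetrizer, Finset.mul_sum, ← Finset.sum_neg_distrib]
  refine Fintype.sum_equiv (Equiv.mulLeft (Equiv.swap i j)) _ _ fun σ => ?_
  simp [Equiv.Perm.sign_swap h]

lemma antisymmetrizer_succ {n : ℕ} (φ : Equiv.Perm (Fin (n + 1)) →* R) :
    antisymmetrizer φ = antisymmetrizer (φ.comp (permFixZero n)) -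
      ∑ j : Fin n, φ (Equiv.swap 0 j.succ) * antisymmetrizer (φ.comp (permFixZero n)) := by
  have h : antisymmetrizer φ = ∑ p : Fin (n + 1), ∑ σ : Equiv.Perm (Fin n),
      ((Equiv.Perm.sign (Equiv.swap 0 p * permFixZero n σ) : ℤ) : ℂ) •
        φ (Equiv.swap 0 p * permFixZero n σ) := by
    rw [antisymmetrizer, ← Equiv.sum_comp Equiv.Perm.decomposeFin.symm, Fintype.sum_prod_type]
    simp only [decomposeFin_symm_eq_swap_mul]
  rw [h, Fin.sum_univ_succ, sub_eq_add_neg, ← Finset.sum_neg_distrib]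
  congr 1
  · simp [antisymmetrizer, sign_permFixZero, ← Equiv.Perm.one_def]
  · refine Finset.sum_congr rfl fun j _ => ?_
    simp [antisymmetrizer, sign_permFixZero, Equiv.Perm.sign_swap (Fin.succ_ne_zero j).symm,
      Finset.mul_sum]

lemma pairList_succ (n : ℕ) : pairList (n + 1) =
    ((List.finRange n).map fun j => ((0 : Fin (n + 1)), j.succ)) ++
      (pairList n).map fun p => (p.1.succ, p.2.succ) := by
  simp [pairList, List.finRange_succ, List.flatMap_map, List.map_flatMap, List.filter_map,
    Function.comp_def]

lemma factorial_pred_succ (n : ℕ) :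
    (((n + 1 - 1).factorial : ℕ) : ℂ) = ((n - 1).factorial : ℂ) * rowScalar n := by
  rcases n with _ | n
  · simp [rowScalar]
  · simp [rowScalar, Nat.factorial_succ, mul_comm]

lemma fused_prod_eq_antisymmetrizer (n : ℕ) (φ : Equiv.Perm (Fin n) →* R) :
    ((pairList n).map fun p =>
      fusedFactor ((p.2 : ℕ) - (p.1 : ℕ)) (φ (Equiv.swap p.1 p.2))).prod =
      ((n - 1).factorial : ℂ) • antisymmetrizer φ := by
  induction n with
  | zero => simp [pairList, antisymmetrizer]
  | succ n ih =>
    have ih' := ih (φ.comp (permFixZero n))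
    simp only [MonoidHom.comp_apply, permFixZero_swap] at ih'
    have hrow := row_mul n (fun j => φ (Equiv.swap 0 j.succ))
      (antisymmetrizer (φ.comp (permFixZero n))) fun i j hij => by
        have hc : Equiv.swap 0 i.succ * Equiv.swap 0 j.succ =
            Equiv.swap 0 j.succ * permFixZero n (Equiv.swap i j) := by
          rw [permFixZero_swap, Equiv.mul_swap_eq_swap_mul _ i.succ, Equiv.swap_apply_right,
            Equiv.swap_apply_of_ne_of_ne (Fin.succ_ne_zero i)
              (fun h => hij (Fin.succ_injective n h)), Equiv.swap_comm]
        rw [← mul_assoc, ← map_mul, hc, map_mul, mul_assoc, ← MonoidHom.comp_apply,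
          swap_mul_antisymmetrizer _ hij, mul_neg]
    simp only [pairList_succ, List.map_append, List.map_map, List.prod_append, Function.comp_def,
      Fin.val_succ, Fin.val_zero, Nat.sub_zero, Nat.add_sub_add_right, ih', mul_smul_comm, hrow,
      smul_smul, ← antisymmetrizer_succ, factorial_pred_succ]

end FusedFactor

/-- The action of permutations on `(ℂ^N)^{⊗N}` by permuting tensor factors. -/
def permRep (N : ℕ) : Equiv.Perm (Fin N) →* Matrix (Fin N → Fin N) (Fin N → Fin N) ℂ where
  toFun σ := Matrix.of fun α β => if β = α ∘ σ then 1 else 0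
  map_one' := by
    ext α β
    simp [Matrix.one_apply, eq_comm]
  map_mul' σ τ := by
    ext α β
    simp only [Matrix.mul_apply, Matrix.of_apply, ite_mul, one_mul, zero_mul,
      Finset.sum_ite_eq', Finset.mem_univ, if_true, Equiv.Perm.coe_mul, Function.comp_assoc]
    congr

lemma permRep_apply {N : ℕ} (σ : Equiv.Perm (Fin N)) (α β : Fin N → Fin N) :
    permRep N σ α β = if β = α ∘ σ then 1 else 0 := rfl

lemma Tfused_eq_fusedFactor {N : ℕ} {i j : Fin N} (h : i < j) :
    Tfused N i j = fusedFactor ((j : ℕ) - (i : ℕ)) (permRep N (Equiv.swap i j)) := by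
  have hij : (i : ℕ) < j := h
  obtain ⟨d, hd⟩ := Nat.exists_eq_add_of_lt hij
  have hsub : (j : ℕ) - i = d + 1 := by omega
  have hsubC : ((j : ℕ) : ℂ) - ((i : ℕ) : ℂ) = d + 1 := by rw [hd]; push_cast; ring
  have hp : permIJ N i j = permRep N (Equiv.swap i j) := rfl
  rw [Tfused, fusedFactor, hsub, hsubC, hp, fusedScalar]
  rcases Nat.eq_zero_or_pos d with rfl | hd0
  · simp [hd]
  · have h1 : (d : ℂ) ≠ 0 := by exact_mod_cast hd0.ne'
    have h2 : (d : ℂ) + 1 ≠ 0 := by exact_mod_cast d.succ_ne_zero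
    rw [if_neg (by omega), if_neg (by omega)]
    push_cast
    rw [smul_sub, smul_sub, smul_smul, smul_smul]
    congr 2 <;> field_simp

lemma levi_perm {n : ℕ} (σ : Equiv.Perm (Fin n)) : levi σ = (Equiv.Perm.sign σ : ℤ) := by
  rw [levi, dif_pos σ.bijective]
  congr 2
  ext
  rfl

lemma levi_of_not_bijective {n : ℕ} {f : Fin n → Fin n} (h : ¬ Function.Bijective f) :
    levi f = 0 := dif_neg h

lemma antisymmetrizer_permRep (N : ℕ) : antisymmetrizer (permRep N) = Eop N := by
  ext α β
  by_cases hα : Function.Bijective α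
  · obtain ⟨a, rfl⟩ : ∃ a : Equiv.Perm (Fin N), ⇑a = α := ⟨Equiv.ofBijective α hα, rfl⟩
    by_cases hβ : Function.Bijective β
    · obtain ⟨b, rfl⟩ : ∃ b : Equiv.Perm (Fin N), ⇑b = β := ⟨Equiv.ofBijective β hβ, rfl⟩
      have hb (σ : Equiv.Perm (Fin N)) : (⇑b = a ∘ σ) ↔ σ = a⁻¹ * b := by
        rw [← Equiv.Perm.coe_mul, DFunLike.coe_fn_eq, eq_inv_mul_iff_mul_eq, eq_comm]
      simp [antisymmetrizer, Eop, Matrix.sum_apply, permRep_apply, levi_perm, hb]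
    · have hb (σ : Equiv.Perm (Fin N)) : β ≠ a ∘ σ := fun h =>
        hβ (h ▸ a.bijective.comp σ.bijective)
      simp [antisymmetrizer, Eop, Matrix.sum_apply, permRep_apply, levi_of_not_bijective hβ, hb]
  · obtain ⟨i, j, hij, hne⟩ : ∃ i j, α i = α j ∧ i ≠ j := by
      have := fun h => hα (Finite.injective_iff_bijective.mp h)
      simpa [Function.Injective] using this
    have hs : α ∘ Equiv.swap i j = α := by
      ext k
      simp only [Function.comp_apply, Equiv.swap_apply_def]
      split_ifs with hi hj <;> simp_all
    have hrow : (permRep N (Equiv.swap i j) * antisymmetrizer (permRep N)) α β =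
        antisymmetrizer (permRep N) α β := by
      simp [Matrix.mul_apply, permRep_apply, hs]
    rw [swap_mul_antisymmetrizer _ hne, Matrix.neg_apply] at hrow
    simp only [Eop, levi_of_not_bijective hα, Int.cast_zero, zero_mul]
    linear_combination (-1 / 2 : ℂ) * hrow

lemma lt_of_mem_pairList {N : ℕ} {p : Fin N × Fin N} (h : p ∈ pairList N) : p.1 < p.2 := by
  simp only [pairList, List.mem_flatMap, List.mem_map, List.mem_filter] at h
  obtain ⟨i, -, j, ⟨-, hij⟩, rfl⟩ := h
  simpa using hij

/-- Fused N-particle identity for SU(N): the lexicographically ordered product of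
the fused operators T_{ij} over all pairs i < j equals (N−1)!·E. -/
theorem fused_N_particle_SUN (N : ℕ) (hN : 2 ≤ N) :
    ((pairList N).map fun p => Tfused N p.1 p.2).prod =
      ((Nat.factorial (N - 1) : ℂ)) • Eop N := by
  rw [List.map_congr_left fun p hp => Tfused_eq_fusedFactor (lt_of_mem_pairList hp),
    fused_prod_eq_antisymmetrizer, antisymmetrizer_permRep]
end
end

section
/- SU(N) minimal form factor and Jost function equation: let φ(θ) := Γ(θ/(2πi))·Γ(1 − 1/N − θ/(2πi)) and let F be the minimal form factor with the normalization constant c₀ := Γ(1/2 − 1/(2N))^{−2(1−1/N)} · exp(−∫₀^∞ e^{t/N}·( sinh((1 − 1/N)t)/(t·sinh²t) − (1 − 1/N)/(t·sinh t) ) dt). Then for every θ ∈ ℂ with 0 < Im θ < 2π/N one has (∏_{k=0}^{N−2} φ(θ + k·iη)) · (∏_{k=0}^{N−1} F(θ + k·iη)) = 1. -/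
open Complex MeasureTheory

noncomputable section

/-- η = 2π/N, as a complex number. -/
def etaC (N : ℕ) : ℂ := 2 * (Real.pi : ℂ) / N

/-- 2πi. -/
def twoPiI : ℂ := 2 * (Real.pi : ℂ) * Complex.I

/-- The exponent integral I(θ) of the SU(N) minimal form factor. -/
def minFFexp (N : ℕ) (θ : ℂ) : ℂ :=
  ∫ t in Set.Ioi (0 : ℝ),
    Complex.exp ((t : ℂ) / N) * Complex.sinh ((t : ℂ) * (1 - 1 / N)) *
      (1 - Complex.cosh ((t : ℂ) * (1 - θ / ((Real.pi : ℂ) * Complex.I)))) /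
        ((t : ℂ) * Complex.sinh (t : ℂ) ^ 2)

/-- The normalization constant
c₀ = Γ(1/2 − 1/(2N))^{−2(1−1/N)}·exp(−∫₀^∞ e^{t/N}(sinh((1−1/N)t)/(t sinh²t)
− (1−1/N)/(t sinh t)) dt) of the SU(N) minimal form factor. -/
def minFFconst (N : ℕ) : ℂ :=
  Complex.Gamma (1 / 2 - 1 / (2 * N)) ^ (-(2 * (1 - 1 / (N : ℂ)))) *
    Complex.exp (-∫ t in Set.Ioi (0 : ℝ),
      Complex.exp ((t : ℂ) / N) *
        (Complex.sinh ((1 - 1 / (N : ℂ)) * t) / ((t : ℂ) * Complex.sinh (t : ℂ) ^ 2) -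
          (1 - 1 / (N : ℂ)) / ((t : ℂ) * Complex.sinh (t : ℂ))))

/-- The SU(N) minimal form factor F(θ) = c₀·exp(I(θ)). -/
def minFF (N : ℕ) (θ : ℂ) : ℂ := minFFconst N * Complex.exp (minFFexp N θ)

/-- The SU(N) Jost function φ(θ) = Γ(θ/(2πi))·Γ(1 − 1/N − θ/(2πi)). -/
def phiJost (N : ℕ) (θ : ℂ) : ℂ :=
  Complex.Gamma (θ / twoPiI) * Complex.Gamma (1 - 1 / N - θ / twoPiI)

theorem norm_exp_neg_mul_sub_le {z w : ℂ} {m t : ℝ} (hz : m ≤ z.re) (hw : m ≤ w.re)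
    (ht : 0 ≤ t) :
    ‖Complex.exp (-z * t) - Complex.exp (-w * t)‖ ≤ ‖z - w‖ * t * Real.exp (-m * t) := by
  have hconv : Convex ℝ {s : ℂ | m ≤ s.re} := convex_halfSpace_re_ge m
  have hder : ∀ s ∈ {s : ℂ | m ≤ s.re},
      HasDerivWithinAt (fun s : ℂ ↦ Complex.exp (-s * t)) (Complex.exp (-s * t) * (-1 * t))
        {s : ℂ | m ≤ s.re} s := fun s _ ↦
    (((hasDerivAt_id s).neg.mul_const (t : ℂ)).cexp).hasDerivWithinAt
  have hbd : ∀ s ∈ {s : ℂ | m ≤ s.re},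
      ‖Complex.exp (-s * t) * (-1 * t)‖ ≤ t * Real.exp (-m * t) := by
    intro s hs
    have hs' : m ≤ s.re := hs
    rw [norm_mul, Complex.norm_exp, mul_comm]
    have h1 : ‖(-1 * t : ℂ)‖ = t := by simp [abs_of_nonneg ht]
    rw [h1]
    gcongr
    simp
    nlinarith
  have := hconv.norm_image_sub_le_of_norm_hasDerivWithin_le hder hbd hw hz
  calc _ ≤ _ := this
    _ = _ := by ring

theorem integrableOn_exp_neg_sub_div {a b : ℂ} (ha : 0 < a.re) (hb : 0 < b.re) :
    IntegrableOn (fun t : ℝ ↦ (Complex.exp (-a * t) - Complex.exp (-b * t)) / t)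
      (Set.Ioi 0) := by
  have hm : 0 < min a.re b.re := lt_min ha hb
  have hint : IntegrableOn (fun t : ℝ ↦ ‖a - b‖ * Real.exp (-(min a.re b.re) * t))
      (Set.Ioi 0) := (integrableOn_exp_mul_Ioi (by linarith) 0).const_mul _
  refine Integrable.mono' hint (Measurable.aestronglyMeasurable (by fun_prop)) ?_
  refine (ae_restrict_iff' measurableSet_Ioi).2 (.of_forall fun t ht ↦ ?_)
  have ht' : 0 < t := ht
  rw [norm_div, div_le_iff₀ (by simpa using ht'.ne'), Complex.norm_real, Real.norm_eq_abs,
    abs_of_pos ht']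
  calc _ ≤ _ := norm_exp_neg_mul_sub_le (min_le_left _ _) (min_le_right _ _) ht'.le
    _ = _ := by ring

/-- Complex Frullani integral for the exponential. -/
theorem exp_integral_exp_neg_sub_div {a b : ℂ} (ha : 0 < a.re) (hb : 0 < b.re) :
    Complex.exp (∫ t in Set.Ioi (0 : ℝ),
      (Complex.exp (-a * t) - Complex.exp (-b * t)) / t) = b / a := by
  set G : ℂ → ℂ := fun s ↦ ∫ t in Set.Ioi (0 : ℝ),
    (Complex.exp (-s * t) - Complex.exp (-b * t)) / t with hG
  have hopen : IsOpen {s : ℂ | 0 < s.re} := isOpen_lt continuous_const Complex.continuous_re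
  have hconn : IsPreconnected {s : ℂ | 0 < s.re} := (convex_halfSpace_re_gt 0).isPreconnected
  have hderG : ∀ s : ℂ, 0 < s.re → HasDerivAt G (-1 / s) s := by
    intro s hs
    have hmem : {r : ℂ | s.re / 2 < r.re} ∈ nhds s :=
      (isOpen_lt continuous_const Complex.continuous_re).mem_nhds (by simp; linarith)
    have key := hasDerivAt_integral_of_dominated_loc_of_deriv_le
      (μ := volume.restrict (Set.Ioi (0 : ℝ)))
      (F := fun (s : ℂ) (t : ℝ) ↦ (Complex.exp (-s * t) - Complex.exp (-b * t)) / t)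
      (F' := fun (s : ℂ) (t : ℝ) ↦ -Complex.exp (-s * t))
      (bound := fun t : ℝ ↦ Real.exp (-(s.re / 2) * t)) hmem
      (.of_forall fun r ↦ Measurable.aestronglyMeasurable (by fun_prop))
      (integrableOn_exp_neg_sub_div hs hb) (by fun_prop)
      ((ae_restrict_iff' measurableSet_Ioi).2 (.of_forall fun t ht r hr ↦ by
        have ht' : 0 < t := ht
        have hr' : s.re / 2 < r.re := hr
        rw [norm_neg, Complex.norm_exp]
        gcongr
        simp
        nlinarith))
      (integrableOn_exp_mul_Ioi (by linarith) 0)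
      ((ae_restrict_iff' measurableSet_Ioi).2 (.of_forall fun t ht r hr ↦ by
        have ht' : (t : ℂ) ≠ 0 := by exact_mod_cast (ne_of_gt ht)
        have h := ((((hasDerivAt_id r).neg.mul_const (t : ℂ)).cexp).sub_const
          (Complex.exp (-b * t))).div_const (t : ℂ)
        refine h.congr_deriv ?_
        simp only [Pi.neg_apply, id_eq]
        field_simp))
    have h2 := key.2
    rw [integral_neg, integral_exp_mul_complex_Ioi (by simpa using hs)] at h2
    refine h2.congr_deriv ?_
    simp [neg_div]
  have hder : ∀ s : ℂ, 0 < s.re → HasDerivAt (fun s ↦ Complex.exp (G s) * s) 0 s := by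
    intro s hs
    have hs0 : s ≠ 0 := by rintro rfl; simp at hs
    refine (((hderG s hs).cexp).mul (hasDerivAt_id s)).congr_deriv ?_
    rw [id_eq]
    field_simp
    ring
  have hconst := hopen.is_const_of_deriv_eq_zero hconn
    (fun s hs ↦ (hder s hs).differentiableAt.differentiableWithinAt)
    (fun s hs ↦ (hder s hs).deriv) (x := a) (y := b) ha hb
  have ha0 : a ≠ 0 := by rintro rfl; simp at ha
  have hGb : G b = 0 := by simp [hG]
  rw [eq_div_iff ha0]
  simpa only [hGb, Complex.exp_zero, one_mul] using hconst

/-- The integrand in the logarithm of `Γ z * Γ w / Γ ((z + w) / 2) ^ 2`. -/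
def gammaKernel (z w : ℂ) (t : ℝ) : ℂ :=
  (Complex.exp (-z * t) - Complex.exp (-w * t)) ^ 2 / (t * (1 - Complex.exp (-2 * t)))

theorem norm_gammaKernel_le {z w : ℂ} {m t : ℝ} (hz : m ≤ z.re) (hw : m ≤ w.re)
    (ht : 0 < t) :
    ‖gammaKernel z w t‖ ≤ ‖z - w‖ ^ 2 * ((1 + t) * Real.exp (-(2 * m) * t)) := by
  have hE : (1 - Complex.exp (-2 * t) : ℂ) = ((1 - Real.exp (-2 * t) : ℝ) : ℂ) := by
    push_cast; rfl
  have hlow : t / (1 + t) ≤ 1 - Real.exp (-2 * t) := by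
    have h1 : 1 + t ≤ Real.exp (2 * t) := by
      have := Real.add_one_le_exp (2 * t); linarith
    have h2 : Real.exp (-2 * t) ≤ (1 + t)⁻¹ := by
      rw [show -2 * t = -(2 * t) by ring, Real.exp_neg]
      exact inv_anti₀ (by linarith) h1
    have h3 : t / (1 + t) = 1 - (1 + t)⁻¹ := by field_simp; ring
    linarith
  have hpos : 0 < t / (1 + t) := by positivity
  have hn := norm_exp_neg_mul_sub_le hz hw ht.le
  rw [gammaKernel, hE, norm_div, norm_pow, norm_mul, Complex.norm_real, Complex.norm_real,
    Real.norm_eq_abs, Real.norm_eq_abs, abs_of_pos ht, abs_of_pos (hpos.trans_le hlow)]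
  calc _ ≤ (‖z - w‖ * t * Real.exp (-m * t)) ^ 2 / (t * (t / (1 + t))) := by gcongr
    _ = _ := by
      rw [show -(2 * m) * t = -m * t + -m * t by ring, Real.exp_add]
      field_simp

theorem integrableOn_gammaKernel_bound {m : ℝ} (hm : 0 < m) (C : ℝ) :
    IntegrableOn (fun t : ℝ ↦ C * ((1 + t) * Real.exp (-(2 * m) * t))) (Set.Ioi 0) := by
  refine Integrable.const_mul ?_ _
  have h1 : IntegrableOn (fun t : ℝ ↦ Real.exp (-(2 * m) * t)) (Set.Ioi 0) :=
    integrableOn_exp_mul_Ioi (by linarith) 0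
  have h2 : IntegrableOn (fun t : ℝ ↦ t * Real.exp (-(2 * m) * t)) (Set.Ioi 0) := by
    have := integrableOn_rpow_mul_exp_neg_mul_rpow (s := 1) (p := 1) (b := 2 * m) (by norm_num)
      one_pos (by linarith)
    simpa using this
  refine (h1.add h2).congr (.of_forall fun t ↦ ?_)
  simp; ring

theorem measurable_gammaKernel (z w : ℂ) : Measurable (gammaKernel z w) := by
  unfold gammaKernel
  fun_prop

theorem integrableOn_gammaKernel {z w : ℂ} (hz : 0 < z.re) (hw : 0 < w.re) :
    IntegrableOn (gammaKernel z w) (Set.Ioi 0) :=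
  Integrable.mono' (integrableOn_gammaKernel_bound (lt_min hz hw) _)
    (measurable_gammaKernel z w).aestronglyMeasurable
    ((ae_restrict_iff' measurableSet_Ioi).2 (.of_forall fun _ ht ↦
      norm_gammaKernel_le (min_le_left _ _) (min_le_right _ _) ht))

theorem one_sub_cexp_neg_two_mul_ne_zero {t : ℝ} (ht : 0 < t) :
    (1 - Complex.exp (-2 * t) : ℂ) ≠ 0 := by
  have hE : (1 - Complex.exp (-2 * t) : ℂ) = ((1 - Real.exp (-2 * t) : ℝ) : ℂ) := by
    push_cast; rfl
  rw [hE, Complex.ofReal_ne_zero]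
  have : Real.exp (-2 * t) < 1 := Real.exp_lt_one_iff.2 (by linarith)
  linarith

theorem exp_integral_gammaKernel_partial {z w : ℂ} (hz : 0 < z.re) (hw : 0 < w.re) (n : ℕ) :
    Complex.exp (∫ t in Set.Ioi (0 : ℝ),
      (1 - Complex.exp (-2 * t) ^ n) * gammaKernel z w t) =
      ∏ j ∈ Finset.range n, ((z + w) / 2 + j) ^ 2 / ((z + j) * (w + j)) := by
  have hre : ∀ (s : ℂ), 0 < s.re → ∀ j : ℕ, 0 < (2 * (s + j)).re := by
    intro s hs j
    have : (0 : ℝ) ≤ j := Nat.cast_nonneg j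
    simp; linarith
  have hs : 0 < ((z + w) / 2).re := by
    rw [Complex.div_ofNat_re]; simp; linarith
  set s := (z + w) / 2 with hsdef
  have hsum : ∀ t ∈ Set.Ioi (0 : ℝ), (1 - Complex.exp (-2 * t) ^ n) * gammaKernel z w t =
      ∑ j ∈ Finset.range n,
        ((Complex.exp (-(2 * (z + j)) * t) - Complex.exp (-(2 * (s + j)) * t)) / t +
        (Complex.exp (-(2 * (w + j)) * t) - Complex.exp (-(2 * (s + j)) * t)) / t) := by
    intro t ht
    have h0 := one_sub_cexp_neg_two_mul_ne_zero ht
    have ht0 : (t : ℂ) ≠ 0 := by exact_mod_cast (ne_of_gt ht)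
    have hterm : ∀ j : ℕ,
        ((Complex.exp (-(2 * (z + j)) * t) - Complex.exp (-(2 * (s + j)) * t)) / t +
        (Complex.exp (-(2 * (w + j)) * t) - Complex.exp (-(2 * (s + j)) * t)) / t) =
        (Complex.exp (-z * t) - Complex.exp (-w * t)) ^ 2 / t * Complex.exp (-2 * t) ^ j := by
      intro j
      have e1 : Complex.exp (-(2 * (z + j)) * t) =
          Complex.exp (-z * t) ^ 2 * Complex.exp (-2 * t) ^ j := by
        rw [← Complex.exp_nat_mul, ← Complex.exp_nat_mul, ← Complex.exp_add]
        congr 1; push_cast; ring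
      have e2 : Complex.exp (-(2 * (w + j)) * t) =
          Complex.exp (-w * t) ^ 2 * Complex.exp (-2 * t) ^ j := by
        rw [← Complex.exp_nat_mul, ← Complex.exp_nat_mul, ← Complex.exp_add]
        congr 1; push_cast; ring
      have e3 : Complex.exp (-(2 * (s + j)) * t) =
          Complex.exp (-z * t) * Complex.exp (-w * t) * Complex.exp (-2 * t) ^ j := by
        rw [← Complex.exp_nat_mul, ← Complex.exp_add, ← Complex.exp_add]
        congr 1; rw [hsdef]; ring
      rw [e1, e2, e3]
      field_simp
      ring
    rw [Finset.sum_congr rfl fun j _ ↦ hterm j, ← Finset.mul_sum,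
      geom_sum_eq (fun h ↦ h0 (by rw [h, sub_self])), gammaKernel]
    rw [← neg_sub (1 : ℂ) (Complex.exp (-2 * t) ^ n), ← neg_sub (1 : ℂ) (Complex.exp (-2 * t)),
      neg_div_neg_eq]
    field_simp
  have hi1 := fun j : ℕ ↦ integrableOn_exp_neg_sub_div (hre z hz j) (hre s hs j)
  have hi2 := fun j : ℕ ↦ integrableOn_exp_neg_sub_div (hre w hw j) (hre s hs j)
  rw [setIntegral_congr_fun measurableSet_Ioi hsum,
    integral_finsetSum _ fun j _ ↦ by exact (hi1 j).add (hi2 j), Complex.exp_sum]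
  refine Finset.prod_congr rfl fun j _ ↦ ?_
  rw [integral_add (hi1 j) (hi2 j), Complex.exp_add,
    exp_integral_exp_neg_sub_div (hre z hz j) (hre s hs j),
    exp_integral_exp_neg_sub_div (hre w hw j) (hre s hs j)]
  have hne : ∀ r : ℂ, 0 < r.re → r + j ≠ 0 := fun r hr h ↦ by
    have := hre r hr j
    simp [h] at this
  have := hne z hz
  have := hne w hw
  field_simp

/-- A Malmsten type formula for products of two Gamma values. -/
theorem Gamma_mul_Gamma_eq_exp_integral {z w : ℂ} (hz : 0 < z.re) (hw : 0 < w.re) :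
    Complex.Gamma z * Complex.Gamma w = Complex.Gamma ((z + w) / 2) ^ 2 *
      Complex.exp (∫ t in Set.Ioi (0 : ℝ), gammaKernel z w t) := by
  have hs : 0 < ((z + w) / 2).re := by
    rw [Complex.div_ofNat_re]; simp; linarith
  have hlim : Filter.Tendsto (fun n : ℕ ↦ ∫ t in Set.Ioi (0 : ℝ),
      (1 - Complex.exp (-2 * t) ^ n) * gammaKernel z w t) Filter.atTop
      (nhds (∫ t in Set.Ioi (0 : ℝ), gammaKernel z w t)) := by
    refine tendsto_integral_of_dominated_convergence
      (fun t ↦ 2 * ‖gammaKernel z w t‖) (fun n ↦ ?_)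
      ((integrableOn_gammaKernel hz hw).norm.const_mul 2) (fun n ↦ ?_) ?_
    · exact (Measurable.mul (by fun_prop) (measurable_gammaKernel z w)).aestronglyMeasurable
    · refine (ae_restrict_iff' measurableSet_Ioi).2 (.of_forall fun t ht ↦ ?_)
      have ht' : 0 < t := ht
      rw [norm_mul]
      gcongr
      refine (norm_sub_le _ _).trans ?_
      have : ‖Complex.exp (-2 * t) ^ n‖ ≤ 1 := by
        rw [norm_pow]
        refine pow_le_one₀ (norm_nonneg _) ?_
        rw [Complex.norm_exp]
        simpa using ht'.le
      rw [norm_one]; linarith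
    · refine (ae_restrict_iff' measurableSet_Ioi).2 (.of_forall fun t ht ↦ ?_)
      have ht' : 0 < t := ht
      have h : Filter.Tendsto (fun n : ℕ ↦ Complex.exp (-2 * t) ^ n) Filter.atTop (nhds 0) := by
        refine tendsto_pow_atTop_nhds_zero_of_norm_lt_one ?_
        rw [Complex.norm_exp]
        simpa using ht'
      simpa using (h.const_sub 1).mul_const (gammaKernel z w t)
  have hlim2 := ((Complex.GammaSeq_tendsto_Gamma ((z + w) / 2)).pow 2).mul
    ((Complex.continuous_exp.tendsto _).comp (hlim.comp (Filter.tendsto_add_atTop_nat 1)))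
  refine tendsto_nhds_unique ((Complex.GammaSeq_tendsto_Gamma z).mul
    (Complex.GammaSeq_tendsto_Gamma w)) (hlim2.congr' ?_)
  filter_upwards [Filter.eventually_ge_atTop 1] with n hn
  have hn0 : (n : ℂ) ≠ 0 := by exact_mod_cast (by omega : n ≠ 0)
  have hne : ∀ r : ℂ, 0 < r.re → ∏ j ∈ Finset.range (n + 1), (r + j) ≠ 0 := by
    intro r hr
    refine Finset.prod_ne_zero_iff.2 fun j _ h ↦ ?_
    have h1 := congrArg Complex.re h
    have : (0 : ℝ) ≤ j := Nat.cast_nonneg j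
    simp at h1
    linarith
  have hp : ((n : ℂ) ^ ((z + w) / 2)) ^ 2 = (n : ℂ) ^ z * (n : ℂ) ^ w := by
    rw [← Complex.cpow_add _ _ hn0, ← Complex.cpow_mul_nat]
    congr 1; push_cast; ring
  have h1 := hne z hz
  have h2 := hne w hw
  have h3 := hne _ hs
  simp only [Function.comp_apply]
  rw [exp_integral_gammaKernel_partial hz hw, Finset.prod_div_distrib, Finset.prod_pow,
    Finset.prod_mul_distrib, Complex.GammaSeq, Complex.GammaSeq, Complex.GammaSeq, div_pow,
    mul_pow, hp]
  generalize ∏ j ∈ Finset.range (n + 1), ((z + w) / 2 + (j : ℂ)) = P at h3 ⊢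
  field_simp

theorem gammaKernel_eq_cosh (z w : ℂ) {t : ℝ} (ht : 0 < t) :
    gammaKernel z w t = Complex.exp ((1 - (z + w)) * t) *
      (Complex.cosh ((z - w) * t) - 1) / (t * Complex.sinh t) := by
  have h0 := one_sub_cexp_neg_two_mul_ne_zero ht
  have ht0 : (t : ℂ) ≠ 0 := by exact_mod_cast ht.ne'
  have hsinh : Complex.sinh t = Complex.exp t * (1 - Complex.exp (-2 * t)) / 2 := by
    rw [Complex.sinh, mul_sub, ← Complex.exp_add, mul_one]
    congr 3; ring
  have hcosh : Complex.exp ((1 - (z + w)) * t) * (Complex.cosh ((z - w) * t) - 1) =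
      Complex.exp t * (Complex.exp (-z * t) - Complex.exp (-w * t)) ^ 2 / 2 := by
    have e1 : Complex.exp ((1 - (z + w)) * t) =
        Complex.exp t * Complex.exp (-z * t) * Complex.exp (-w * t) := by
      rw [← Complex.exp_add, ← Complex.exp_add]; congr 1; ring
    have e2 : Complex.exp ((z - w) * t) = Complex.exp (-w * t) / Complex.exp (-z * t) := by
      rw [← Complex.exp_sub]; congr 1; ring
    have e3 : Complex.exp (-((z - w) * t)) = Complex.exp (-z * t) / Complex.exp (-w * t) := by
      rw [← Complex.exp_sub]; congr 1; ring
    rw [Complex.cosh, e1, e2, e3]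
    have hz := Complex.exp_ne_zero (-z * t)
    have hw := Complex.exp_ne_zero (-w * t)
    field_simp
    ring
  have he := Complex.exp_ne_zero (t : ℂ)
  rw [hcosh, hsinh, gammaKernel]
  field_simp

theorem sinh_mul_sum_cosh (c d : ℂ) (n : ℕ) :
    Complex.sinh d * ∑ k ∈ Finset.range n, Complex.cosh (c - 2 * k * d) =
      Complex.sinh (n * d) * Complex.cosh (c - (n - 1) * d) := by
  induction n with
  | zero => simp
  | succ n ih =>
    rw [Finset.sum_range_succ, mul_add, ih]
    push_cast
    have e1 : c - (n - 1) * d = (c - n * d) + d := by ring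
    have e2 : c - 2 * n * d = (c - n * d) - n * d := by ring
    have e3 : c - (n + 1 - 1) * d = c - n * d := by ring
    have e4 : ((n : ℂ) + 1) * d = n * d + d := by ring
    rw [e1, e2, e3, e4]
    generalize c - n * d = u
    rw [Complex.cosh_add, Complex.cosh_sub, Complex.sinh_add]
    ring

theorem exp_mul_sinh_div_sinh_le {b t : ℝ} (hb : b ≤ 1) (ht : 0 < t) :
    Real.exp ((1 - b) * t) * Real.sinh (b * t) / Real.sinh t ≤ 1 := by
  have hs : 0 < Real.sinh t := Real.sinh_pos_iff.2 ht
  rw [div_le_one hs, Real.sinh_eq, Real.sinh_eq, mul_div_assoc', mul_sub, ← Real.exp_add,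
    ← Real.exp_add]
  gcongr ?_ / 2
  have h1 : (1 - b) * t + b * t = t := by ring
  rw [h1]
  gcongr
  nlinarith

/-- The integrand of `minFFexp`. -/
def minFFexpIntegrand (N : ℕ) (θ : ℂ) (t : ℝ) : ℂ :=
  Complex.exp ((t : ℂ) / N) * Complex.sinh ((t : ℂ) * (1 - 1 / N)) *
    (1 - Complex.cosh ((t : ℂ) * (1 - θ / ((Real.pi : ℂ) * Complex.I)))) /
      ((t : ℂ) * Complex.sinh (t : ℂ) ^ 2)

theorem re_div_pi_mul_I (θ : ℂ) : (θ / ((Real.pi : ℂ) * Complex.I)).re = θ.im / Real.pi := by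
  rw [← div_div, Complex.div_I]
  simp [Complex.div_ofReal_im]

theorem integrableOn_minFFexpIntegrand {N : ℕ} (hN : 2 ≤ N) {θ : ℂ} (h1 : 0 < θ.im)
    (h2 : θ.im < 2 * Real.pi) : IntegrableOn (minFFexpIntegrand N θ) (Set.Ioi 0) := by
  set x : ℂ := θ / ((Real.pi : ℂ) * Complex.I) with hx
  have hxre : x.re = θ.im / Real.pi := re_div_pi_mul_I θ
  have hx0 : 0 < x.re := by rw [hxre]; exact div_pos h1 Real.pi_pos
  have hx2 : x.re < 2 := by rw [hxre, div_lt_iff₀ Real.pi_pos]; exact h2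
  have hN' : (2 : ℝ) ≤ N := by exact_mod_cast hN
  have hJ : IntegrableOn (gammaKernel (1 - x / 2) (x / 2)) (Set.Ioi 0) := by
    apply integrableOn_gammaKernel
    · rw [Complex.sub_re, Complex.div_ofNat_re, Complex.one_re]; linarith
    · rw [Complex.div_ofNat_re]; linarith
  set b : ℝ := 1 - 1 / N with hb
  have hb1 : b ≤ 1 := by
    have : (0 : ℝ) ≤ 1 / N := by positivity
    linarith
  have hb0 : 0 ≤ b := by
    rw [hb, sub_nonneg, div_le_one (by linarith)]; linarith
  have hq : ∀ t ∈ Set.Ioi (0 : ℝ),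
      ‖((-(Real.exp ((1 - b) * t) * Real.sinh (b * t) / Real.sinh t) : ℝ) : ℂ)‖ ≤ 1 := by
    intro t ht
    have ht' : 0 < t := ht
    have hs : 0 < Real.sinh t := Real.sinh_pos_iff.2 ht'
    have hs' : 0 ≤ Real.sinh (b * t) := Real.sinh_nonneg_iff.2 (by positivity)
    rw [Complex.norm_real, norm_neg, Real.norm_of_nonneg (by positivity)]
    exact exp_mul_sinh_div_sinh_le hb1 ht'
  have hI := hJ.bdd_mul (c := 1)
    (f := fun t : ℝ ↦ ((-(Real.exp ((1 - b) * t) * Real.sinh (b * t) / Real.sinh t) : ℝ) : ℂ))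
    (Measurable.aestronglyMeasurable (by fun_prop))
    ((ae_restrict_iff' measurableSet_Ioi).2 (.of_forall hq))
  refine hI.congr ((ae_restrict_iff' measurableSet_Ioi).2 (.of_forall fun t ht ↦ ?_))
  have ht' : 0 < t := ht
  have ht0 : (t : ℂ) ≠ 0 := by exact_mod_cast ht'.ne'
  have hs : Complex.sinh t ≠ 0 := by
    rw [← Complex.ofReal_sinh]; exact_mod_cast (Real.sinh_pos_iff.2 ht').ne'
  simp only [gammaKernel_eq_cosh _ _ ht', minFFexpIntegrand, ← hx]
  have e1 : (1 - (1 - x / 2 + x / 2)) * (t : ℂ) = 0 := by ring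
  have e2 : (1 - x / 2 - x / 2) * (t : ℂ) = t * (1 - x) := by ring
  have e3 : ((1 - b) * t : ℂ) = t / N := by rw [hb]; push_cast; ring
  have e4 : (b * t : ℂ) = t * (1 - 1 / N) := by rw [hb]; push_cast; ring
  rw [e1, e2, Complex.exp_zero]
  push_cast
  rw [e3, e4]
  field_simp
  ring

/-- The integrand of the exponent in `minFFconst`. -/
def minFFconstIntegrand (N : ℕ) (t : ℝ) : ℂ :=
  Complex.exp ((t : ℂ) / N) *
    (Complex.sinh ((1 - 1 / (N : ℂ)) * t) / ((t : ℂ) * Complex.sinh (t : ℂ) ^ 2) -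
      (1 - 1 / (N : ℂ)) / ((t : ℂ) * Complex.sinh (t : ℂ)))

theorem minFFconstIntegrand_mul_eq_sum (n : ℕ) (θ : ℂ) {t : ℝ} (ht : 0 < t) :
    ((n + 1 : ℕ) : ℂ) * minFFconstIntegrand (n + 1) t =
      ∑ k ∈ Finset.range (n + 1),
        minFFexpIntegrand (n + 1) (θ + k * (Complex.I * etaC (n + 1))) t +
      ∑ k ∈ Finset.range n,
        gammaKernel ((θ + k * (Complex.I * etaC (n + 1))) / twoPiI)
          (1 - 1 / ((n + 1 : ℕ) : ℂ) - (θ + k * (Complex.I * etaC (n + 1))) / twoPiI) t := by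
  set N : ℂ := ((n + 1 : ℕ) : ℂ) with hN
  have hN0 : N ≠ 0 := by rw [hN]; exact_mod_cast n.succ_ne_zero
  have hn : (n : ℂ) = N - 1 := by rw [hN]; push_cast; ring
  have ht0 : (t : ℂ) ≠ 0 := by exact_mod_cast ht.ne'
  have hs : Complex.sinh t ≠ 0 := by
    rw [← Complex.ofReal_sinh]; exact_mod_cast (Real.sinh_pos_iff.2 ht).ne'
  have hd : Complex.sinh (t / N) ≠ 0 := by
    have : (t / N : ℂ) = ((t / (n + 1 : ℕ) : ℝ) : ℂ) := by rw [hN]; push_cast; rfl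
    rw [this, ← Complex.ofReal_sinh]
    exact_mod_cast (Real.sinh_pos_iff.2 (by positivity)).ne'
  have hpi : (Real.pi : ℂ) ≠ 0 := by exact_mod_cast Real.pi_ne_zero
  set x : ℂ := θ / ((Real.pi : ℂ) * Complex.I) with hx
  have hI : ∀ k : ℕ, minFFexpIntegrand (n + 1) (θ + k * (Complex.I * etaC (n + 1))) t =
      Complex.exp (t / N) * Complex.sinh (t * (1 - 1 / N)) / (t * Complex.sinh t ^ 2) *
        (1 - Complex.cosh (t * (1 - x) - 2 * k * (t / N))) := by
    intro k
    have e : (t : ℂ) * (1 - (θ + k * (Complex.I * etaC (n + 1))) / ((Real.pi : ℂ) * Complex.I)) =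
        t * (1 - x) - 2 * k * (t / N) := by
      rw [hx, etaC, ← hN]
      have := Complex.I_ne_zero
      field_simp
      ring
    rw [minFFexpIntegrand, e, ← hN]
    ring
  have hG : ∀ k : ℕ, gammaKernel ((θ + k * (Complex.I * etaC (n + 1))) / twoPiI)
      (1 - 1 / N - (θ + k * (Complex.I * etaC (n + 1))) / twoPiI) t =
      Complex.exp (t / N) / (t * Complex.sinh t) *
        (Complex.cosh (t * (1 - 1 / N - x) - 2 * k * (t / N)) - 1) := by
    intro k
    set z := (θ + k * (Complex.I * etaC (n + 1))) / twoPiI with hz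
    have e : z = x / 2 + k / N := by
      rw [hz, hx, etaC, ← hN, twoPiI]
      have := Complex.I_ne_zero
      field_simp
    have e1 : (1 - (z + (1 - 1 / N - z))) * (t : ℂ) = t / N := by ring
    have e2 : (z - (1 - 1 / N - z)) * (t : ℂ) =
        -(t * (1 - 1 / N - x) - 2 * k * (t / N)) := by rw [e]; ring
    rw [gammaKernel_eq_cosh _ _ ht, e1, e2, Complex.cosh_neg]
    ring
  simp only [hI, hG, ← Finset.mul_sum, Finset.sum_sub_distrib, Finset.sum_const,
    Finset.card_range, nsmul_eq_mul, mul_one]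
  have h1 := sinh_mul_sum_cosh (t * (1 - x)) (t / N) (n + 1)
  have h2 := sinh_mul_sum_cosh (t * (1 - 1 / N - x)) (t / N) n
  have a1 : N * (t / N) = (t : ℂ) := by field_simp
  have a2 : (n : ℂ) * (t / N) = t * (1 - 1 / N) := by rw [hn]; field_simp
  have a3 : t * (1 - x) - (N - 1) * (t / N) = t * (1 / N - x) := by field_simp; ring
  have a4 : t * (1 - 1 / N - x) - (n - 1) * (t / N) = t * (1 / N - x) := by
    rw [hn]; field_simp; ring
  rw [← hN, a1, a3] at h1
  rw [a2, a4] at h2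
  rw [← hN, minFFconstIntegrand, ← hN, hn, mul_comm (1 - 1 / N) (t : ℂ)]
  set S1 := ∑ k ∈ Finset.range (n + 1), Complex.cosh (t * (1 - x) - 2 * k * (t / N))
  set S2 := ∑ k ∈ Finset.range n, Complex.cosh (t * (1 - 1 / N - x) - 2 * k * (t / N))
  have h3 : Complex.sinh (t * (1 - 1 / N)) * S1 = Complex.sinh t * S2 := by
    apply mul_left_cancel₀ hd
    linear_combination Complex.sinh (t * (1 - 1 / N)) * h1 - Complex.sinh t * h2
  generalize Complex.sinh (t * (1 - 1 / N)) = A at h3 ⊢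
  generalize Complex.exp (t / N) = E
  field_simp
  linear_combination E * h3

/-- SU(N) minimal form factor and Jost function equation:
(∏_{k=0}^{N−2} φ(θ + k·iη))·(∏_{k=0}^{N−1} F(θ + k·iη)) = 1 for 0 < Im θ < 2π/N. -/
theorem minFF_phi_equation_SUN (N : ℕ) (hN : 2 ≤ N) (θ : ℂ)
    (h1 : 0 < θ.im) (h2 : θ.im < 2 * Real.pi / N) :
    (∏ k ∈ Finset.range (N - 1), phiJost N (θ + (k : ℂ) * (Complex.I * etaC N))) *
        (∏ k ∈ Finset.range N, minFF N (θ + (k : ℂ) * (Complex.I * etaC N))) = 1 := by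
  obtain ⟨n, rfl⟩ : ∃ n, N = n + 1 := ⟨N - 1, by omega⟩
  rw [Nat.add_sub_cancel]
  have hNpos : (0 : ℝ) < ((n + 1 : ℕ) : ℝ) := by positivity
  have hn1 : (1 : ℝ) ≤ n := by exact_mod_cast (by omega : 1 ≤ n)
  have hpi := Real.pi_pos
  have him : ∀ k : ℕ, (θ + k * (Complex.I * etaC (n + 1))).im =
      θ.im + k * (2 * Real.pi / ((n + 1 : ℕ) : ℝ)) := by
    intro k
    have : (k : ℂ) * (Complex.I * etaC (n + 1)) =
        ((k * (2 * Real.pi / ((n + 1 : ℕ) : ℝ)) : ℝ) : ℂ) * Complex.I := by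
      rw [etaC]; push_cast; ring
    rw [this, Complex.add_im, Complex.im_ofReal_mul, Complex.I_im, mul_one]
  have hpos : ∀ k : ℕ, 0 < (θ + k * (Complex.I * etaC (n + 1))).im := fun k ↦ by
    rw [him]; positivity
  have hub : ∀ k m : ℕ, k + 1 ≤ m → (θ + k * (Complex.I * etaC (n + 1))).im <
      m * (2 * Real.pi / ((n + 1 : ℕ) : ℝ)) := fun k m hk ↦ by
    have hk' : (k : ℝ) + 1 ≤ m := by exact_mod_cast hk
    have h3 : 0 < 2 * Real.pi / ((n + 1 : ℕ) : ℝ) := by positivity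
    rw [him]
    nlinarith
  have hI : ∀ k ∈ Finset.range (n + 1), IntegrableOn
      (minFFexpIntegrand (n + 1) (θ + k * (Complex.I * etaC (n + 1)))) (Set.Ioi 0) := by
    intro k hk
    refine integrableOn_minFFexpIntegrand hN (hpos k) ?_
    refine (hub k (n + 1) (Finset.mem_range.1 hk)).trans_eq ?_
    field_simp
  have hzre : ∀ s : ℂ, (s / twoPiI).re = s.im / (2 * Real.pi) := fun s ↦ by
    rw [twoPiI, mul_assoc, ← div_div, div_right_comm, Complex.div_ofNat_re, re_div_pi_mul_I]
    field_simp
  have hz : ∀ k : ℕ, 0 < ((θ + k * (Complex.I * etaC (n + 1))) / twoPiI).re := fun k ↦ by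
    rw [hzre]; exact div_pos (hpos k) (by positivity)
  have hw : ∀ k ∈ Finset.range n, 0 < (1 - 1 / ((n + 1 : ℕ) : ℂ) -
      (θ + k * (Complex.I * etaC (n + 1))) / twoPiI).re := by
    intro k hk
    have e : (1 - 1 / ((n + 1 : ℕ) : ℂ)) = ((n / ((n + 1 : ℕ) : ℝ) : ℝ) : ℂ) := by
      have : ((n : ℂ) + 1) ≠ 0 := by exact_mod_cast n.succ_ne_zero
      push_cast; field_simp; ring
    rw [e, Complex.sub_re, hzre, Complex.ofReal_re, sub_pos, div_lt_iff₀ (by positivity)]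
    refine (hub k n (Finset.mem_range.1 hk)).trans_eq ?_
    ring
  have hJ := fun k hk ↦ integrableOn_gammaKernel (hz k) (hw k hk)
  have hK : ((n + 1 : ℕ) : ℂ) * ∫ t in Set.Ioi (0 : ℝ), minFFconstIntegrand (n + 1) t =
      ∑ k ∈ Finset.range (n + 1), minFFexp (n + 1) (θ + k * (Complex.I * etaC (n + 1))) +
      ∑ k ∈ Finset.range n, ∫ t in Set.Ioi (0 : ℝ),
        gammaKernel ((θ + k * (Complex.I * etaC (n + 1))) / twoPiI)
          (1 - 1 / ((n + 1 : ℕ) : ℂ) - (θ + k * (Complex.I * etaC (n + 1))) / twoPiI) t := by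
    rw [← integral_const_mul, setIntegral_congr_fun measurableSet_Ioi
      fun t ht ↦ minFFconstIntegrand_mul_eq_sum n θ ht,
      integral_add (integrable_finsetSum _ hI) (integrable_finsetSum _ hJ),
      integral_finsetSum _ hI, integral_finsetSum _ hJ]
    rfl
  set g := Complex.Gamma (1 / 2 - 1 / (2 * ((n + 1 : ℕ) : ℂ))) with hg
  have hphi : ∀ k ∈ Finset.range n, phiJost (n + 1) (θ + k * (Complex.I * etaC (n + 1))) =
      g ^ 2 * Complex.exp (∫ t in Set.Ioi (0 : ℝ),
        gammaKernel ((θ + k * (Complex.I * etaC (n + 1))) / twoPiI)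
          (1 - 1 / ((n + 1 : ℕ) : ℂ) - (θ + k * (Complex.I * etaC (n + 1))) / twoPiI) t) := by
    intro k hk
    rw [phiJost, Gamma_mul_Gamma_eq_exp_integral (hz k) (hw k hk), hg]
    congr 3
    ring
  have hg0 : g ≠ 0 := by
    refine Complex.Gamma_ne_zero_of_re_pos ?_
    have e : (1 / 2 - 1 / (2 * ((n + 1 : ℕ) : ℂ))) =
        ((n / (2 * ((n + 1 : ℕ) : ℝ)) : ℝ) : ℂ) := by
      have : ((n : ℂ) + 1) ≠ 0 := by exact_mod_cast n.succ_ne_zero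
      push_cast; field_simp; ring
    rw [e, Complex.ofReal_re]
    positivity
  have hconst : minFFconst (n + 1) ^ (n + 1) = (g ^ (2 * n))⁻¹ * Complex.exp
      (-(((n + 1 : ℕ) : ℂ) * ∫ t in Set.Ioi (0 : ℝ), minFFconstIntegrand (n + 1) t)) := by
    have hpow : (g ^ (-(2 * (1 - 1 / ((n + 1 : ℕ) : ℂ))))) ^ (n + 1) = (g ^ (2 * n))⁻¹ := by
      rw [← Complex.cpow_mul_nat, ← Complex.cpow_natCast, ← Complex.cpow_neg]
      congr 1
      have : ((n : ℂ) + 1) ≠ 0 := by exact_mod_cast n.succ_ne_zero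
      push_cast
      field_simp
      ring
    rw [minFFconst, mul_pow, ← hg, hpow, ← Complex.exp_nat_mul, mul_neg]
    rfl
  rw [Finset.prod_congr rfl hphi]
  simp only [minFF]
  rw [Finset.prod_mul_distrib, Finset.prod_mul_distrib, ← Complex.exp_sum, ← Complex.exp_sum,
    Finset.prod_const, Finset.prod_const, Finset.card_range, Finset.card_range, hconst, hK,
    ← pow_mul]
  generalize ∑ k ∈ Finset.range (n + 1), minFFexp (n + 1) (θ + k * (Complex.I * etaC (n + 1))) = P
  generalize ∑ k ∈ Finset.range n, (∫ t in Set.Ioi (0 : ℝ), _ : ℂ) = Q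
  have hgp : g ^ (2 * n) ≠ 0 := pow_ne_zero _ hg0
  rw [neg_add, Complex.exp_add, Complex.exp_neg, Complex.exp_neg]
  field_simp
end
end
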